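/- arXiv:1808.03411 — 2 statements merged into one kernel-verified Lean document; each statement's English description precedes it below -/
import Mathlib

section
/- Suppose x_i ≠ 1 for all i = 1, …, n, and S = Σ_{i=1}^n 1/(1 − x_i) satisfies S ≠ 1 (so that M is invertible). Then jᵀ M^{-1} j = S/(S − 1), where j is the all-ones column vector in ℝ^n. -/
open Matrix BigOperators

/-- `Mmat x` is the matrix with diagonal entries `x i` and all off-diagonal entries `1`. -/
def Mmat {n : ℕ} (x : Fin n → ℝ) : Matrix (Fin n) (Fin n) ℝ :=
  Matrix.of fun i j => if i = j then x i else 1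

/-- The identity `M = J - D`, applied to a vector. -/
theorem Mmat_mulVec_apply {n : ℕ} (x v : Fin n → ℝ) (i : Fin n) :
    (Mmat x *ᵥ v) i = ∑ j, v j - (1 - x i) * v i := by
  have h : ∀ j, (if i = j then x i else 1) * v j = v j - if i = j then (1 - x i) * v i else 0 := by
    intro j
    split_ifs with hij
    · subst hij
      ring
    · ring
  simp [Mmat, mulVec, dotProduct, h, Finset.sum_sub_distrib]

/-- The coordinate sum of a solution of `M v = c j`, up to the factor `1 - S`. -/
theorem sum_eq_of_Mmat_mulVec_eq {n : ℕ} {x v : Fin n → ℝ} (hx : ∀ i, x i ≠ 1) {c : ℝ}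
    (hv : ∀ i, (Mmat x *ᵥ v) i = c) :
    ∑ i, v i = (∑ i, v i - c) * ∑ i, 1 / (1 - x i) := by
  rw [Finset.mul_sum]
  refine Finset.sum_congr rfl fun i _ => ?_
  have h := hv i
  rw [Mmat_mulVec_apply] at h
  have hi : 1 - x i ≠ 0 := sub_ne_zero.mpr (hx i).symm
  rw [mul_one_div, eq_div_iff hi]
  linarith

theorem isUnit_Mmat {n : ℕ} {x : Fin n → ℝ} (hx : ∀ i, x i ≠ 1)
    (hS : ∑ i, 1 / (1 - x i) ≠ 1) : IsUnit (Mmat x) := by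
  rw [← mulVec_injective_iff_isUnit]
  refine (injective_iff_map_eq_zero (Mmat x).mulVecLin).mpr fun v hv => ?_
  have hv' : ∀ i, (Mmat x *ᵥ v) i = 0 := congrFun hv
  have hs := sum_eq_of_Mmat_mulVec_eq hx hv'
  have hs0 : ∑ i, v i = 0 := by
    rw [sub_zero] at hs
    by_contra hne
    exact hS (mul_left_cancel₀ hne (by rw [← hs, mul_one]))
  ext i
  have h := hv' i
  rw [Mmat_mulVec_apply, hs0, zero_sub, neg_eq_zero] at h
  exact (mul_eq_zero.mp h).resolve_left (sub_ne_zero.mpr (hx i).symm)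

/-- if `x i ≠ 1` for all `i` and `S = ∑ i, 1/(1 - x i) ≠ 1` (so `M` is
invertible), then `jᵀ M⁻¹ j = S/(S-1)`, where `j` is the all-ones vector. -/
theorem stmt_8 {n : ℕ} (hn : 1 ≤ n) (x : Fin n → ℝ) (hx : ∀ i, x i ≠ 1)
    (S : ℝ) (hS : S = ∑ i, 1 / (1 - x i)) (hS1 : S ≠ 1) :
    (1 : Fin n → ℝ) ⬝ᵥ ((Mmat x)⁻¹ *ᵥ (1 : Fin n → ℝ)) = S / (S - 1) := by
  subst hS
  have hv : Mmat x *ᵥ ((Mmat x)⁻¹ *ᵥ 1) = 1 := by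
    rw [mulVec_mulVec, mul_nonsing_inv _ ((isUnit_iff_isUnit_det _).mp (isUnit_Mmat hx hS1)),
      one_mulVec]
  have hs := sum_eq_of_Mmat_mulVec_eq hx (c := 1) (congrFun hv)
  rw [one_dotProduct, eq_div_iff (sub_ne_zero.mpr hS1)]
  linarith
end

section
/- Suppose x_i ≠ 1 for all i = 1, …, n, and S = Σ_{i=1}^n 1/(1 − x_i) satisfies S ≠ 1. Then for every real number α, every k ≥ 0, every vector w ∈ ℝ^k and every k×k real matrix C, det N = det M · det([[α − S/(S−1), wᵀ],[w, C]]), where N = [[M, j, O],[jᵀ, α, wᵀ],[O, w, C]]. In particular, N is nonsingular if and only if [[α − S/(S−1), wᵀ],[w, C]] is nonsingular. -/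
open Matrix BigOperators

/-- `Nmat x α w C` is the block matrix `[[M, j, O],[jᵀ, α, wᵀ],[O, w, C]]`. -/
def Nmat {n k : ℕ} (x : Fin n → ℝ) (α : ℝ) (w : Fin k → ℝ)
    (C : Matrix (Fin k) (Fin k) ℝ) :
    Matrix ((Fin n ⊕ Unit) ⊕ Fin k) ((Fin n ⊕ Unit) ⊕ Fin k) ℝ :=
  Matrix.fromBlocks
    (Matrix.fromBlocks (Mmat x) (fun _ _ => 1) (fun _ _ => 1) (fun _ _ => α))
    (Matrix.of fun p (j : Fin k) => Sum.elim (fun _ : Fin n => (0 : ℝ)) (fun _ : Unit => w j) p)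
    (Matrix.of fun (i : Fin k) p => Sum.elim (fun _ : Fin n => (0 : ℝ)) (fun _ : Unit => w i) p)
    C

/-- `Smat β w C` is the bordered matrix `[[β, wᵀ],[w, C]]`. -/
def Smat {k : ℕ} (β : ℝ) (w : Fin k → ℝ) (C : Matrix (Fin k) (Fin k) ℝ) :
    Matrix (Unit ⊕ Fin k) (Unit ⊕ Fin k) ℝ :=
  Matrix.fromBlocks (fun _ _ => β) (fun _ j => w j) (fun i _ => w i) C

theorem Mmat_mulVec {n : ℕ} (x u : Fin n → ℝ) (i : Fin n) :
    (Mmat x *ᵥ u) i = ∑ j, u j - (1 - x i) * u i := by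
  have h : ∀ j, Mmat x i j * u j = u j - if i = j then (1 - x i) * u i else 0 := by
    intro j
    by_cases hij : i = j
    · subst hij
      simp only [Mmat, of_apply, if_true]
      ring
    · simp [Mmat, hij]
  simp [mulVec, dotProduct, h, Finset.sum_sub_distrib]

theorem det_Mmat_ne_zero {n : ℕ} {x : Fin n → ℝ} (hx : ∀ i, x i ≠ 1)
    (hS1 : ∑ i, 1 / (1 - x i) ≠ 1) : (Mmat x).det ≠ 0 := by
  intro h
  obtain ⟨u, hu0, hu⟩ := exists_mulVec_eq_zero_iff.mpr h
  have hui : ∀ i, u i = (∑ j, u j) * (1 / (1 - x i)) := by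
    intro i
    have hi := congrFun hu i
    rw [Mmat_mulVec, Pi.zero_apply] at hi
    have hne : 1 - x i ≠ 0 := sub_ne_zero.mpr (hx i).symm
    field_simp
    linarith
  have hsum : ∑ j, u j = (∑ j, u j) * ∑ i, 1 / (1 - x i) := by
    rw [Finset.mul_sum]
    exact Finset.sum_congr rfl fun i _ => hui i
  have hzero : ∑ j, u j = 0 := by
    by_contra hne
    exact hS1 (mul_left_cancel₀ hne (by rw [← hsum, mul_one]))
  exact hu0 (funext fun i => by rw [hui i, hzero, zero_mul, Pi.zero_apply])

/-- The solution `v` of `M v = j`. -/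
noncomputable def MmatSol {n : ℕ} (x : Fin n → ℝ) (i : Fin n) : ℝ :=
  1 / (1 - x i) / (∑ j, 1 / (1 - x j) - 1)

theorem sum_MmatSol {n : ℕ} (x : Fin n → ℝ) :
    ∑ i, MmatSol x i = (∑ j, 1 / (1 - x j)) / (∑ j, 1 / (1 - x j) - 1) := by
  simp only [MmatSol, ← Finset.sum_div]

theorem Mmat_mulVec_MmatSol {n : ℕ} {x : Fin n → ℝ} (hx : ∀ i, x i ≠ 1)
    (hS1 : ∑ i, 1 / (1 - x i) ≠ 1) : Mmat x *ᵥ MmatSol x = 1 := by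
  funext i
  have hne : 1 - x i ≠ 0 := sub_ne_zero.mpr (hx i).symm
  rw [Mmat_mulVec, sum_MmatSol, MmatSol, Pi.one_apply]
  generalize ∑ j, 1 / (1 - x j) = S at hS1 ⊢
  have hS : S - 1 ≠ 0 := sub_ne_zero.mpr hS1
  field_simp

/-- The matrix with `u` in the `Unit` column and zeros elsewhere. -/
def borderCol {n : ℕ} (k : ℕ) (u : Fin n → ℝ) : Matrix (Fin n) (Unit ⊕ Fin k) ℝ :=
  Matrix.of fun i => Sum.elim (fun _ => u i) (fun _ => 0)

theorem mul_borderCol {n : ℕ} (k : ℕ) (A : Matrix (Fin n) (Fin n) ℝ) (u : Fin n → ℝ) :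
    A * borderCol k u = borderCol k (A *ᵥ u) := by
  ext i (j | j) <;> simp [borderCol, mul_apply, mulVec, dotProduct]

theorem Smat_sub_borderCol {n k : ℕ} (α : ℝ) (w : Fin k → ℝ) (C : Matrix (Fin k) (Fin k) ℝ)
    (u : Fin n → ℝ) :
    Smat α w C - (borderCol k (1 : Fin n → ℝ))ᵀ * borderCol k u = Smat (α - ∑ i, u i) w C := by
  ext (i | i) (j | j) <;> simp [Smat, borderCol, mul_apply, fromBlocks]

theorem Nmat_reindex {n k : ℕ} (x : Fin n → ℝ) (α : ℝ) (w : Fin k → ℝ)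
    (C : Matrix (Fin k) (Fin k) ℝ) :
    reindex (Equiv.sumAssoc _ _ _) (Equiv.sumAssoc _ _ _) (Nmat x α w C) =
      fromBlocks (Mmat x) (borderCol k 1) (borderCol k 1)ᵀ (Smat α w C) := by
  ext (i | i | i) (j | j | j) <;> simp [Nmat, Smat, borderCol, fromBlocks]

theorem det_Nmat {n k : ℕ} {x : Fin n → ℝ} (hx : ∀ i, x i ≠ 1)
    (hS1 : ∑ i, 1 / (1 - x i) ≠ 1) (α : ℝ) (w : Fin k → ℝ) (C : Matrix (Fin k) (Fin k) ℝ) :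
    (Nmat x α w C).det = (Mmat x).det *
      (Smat (α - (∑ i, 1 / (1 - x i)) / (∑ i, 1 / (1 - x i) - 1)) w C).det := by
  let := invertibleOfIsUnitDet (Mmat x) (det_Mmat_ne_zero hx hS1).isUnit
  have hinv : ⅟(Mmat x) * borderCol k (1 : Fin n → ℝ) = borderCol k (MmatSol x) := by
    rw [← Mmat_mulVec_MmatSol hx hS1, ← mul_borderCol, ← Matrix.mul_assoc, invOf_mul_self,
      Matrix.one_mul]
  rw [← det_reindex_self (Equiv.sumAssoc _ _ _), Nmat_reindex, det_fromBlocks₁₁,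
    Matrix.mul_assoc, hinv, Smat_sub_borderCol, sum_MmatSol]

/-- if `x i ≠ 1` for all `i` and `S = ∑ i, 1/(1 - x i) ≠ 1`, then
`det N = det M * det [[α - S/(S-1), wᵀ],[w, C]]`; in particular `N` is nonsingular iff
`[[α - S/(S-1), wᵀ],[w, C]]` is. -/
theorem stmt_10 {n : ℕ} (hn : 1 ≤ n) (x : Fin n → ℝ) (hx : ∀ i, x i ≠ 1)
    (S : ℝ) (hS : S = ∑ i, 1 / (1 - x i)) (hS1 : S ≠ 1)
    (α : ℝ) {k : ℕ} (w : Fin k → ℝ) (C : Matrix (Fin k) (Fin k) ℝ) :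
    (Nmat x α w C).det = (Mmat x).det * (Smat (α - S / (S - 1)) w C).det ∧
      ((Nmat x α w C).det ≠ 0 ↔ (Smat (α - S / (S - 1)) w C).det ≠ 0) := by
  subst hS
  refine ⟨det_Nmat hx hS1 α w C, ?_⟩
  rw [det_Nmat hx hS1, mul_ne_zero_iff, and_iff_right (det_Mmat_ne_zero hx hS1)]
end
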